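/- arXiv:2505.00631 — 3 statements merged into one kernel-verified Lean document; each statement's English description precedes it below -/
import Mathlib

section
/- Let (Ω, 𝔉, μ) be a probability space with measurable X : Ω → 𝒳, Y : Ω → {0,1}, S : Ω → {1,…,M}, μ(S=m) > 0 for all m. For measurable f : 𝒳 → [0,1] define R_cs(f; c) := c·∫ f(X)·1_{Y=0} dμ + (1−c)·∫ (1−f(X))·1_{Y=1} dμ and MD_m(f) := ∫ f∘X dμ − (∫ f(X)·1_{S=m} dμ)/μ(S=m). Then for every c ∈ [0,1] and δ ∈ [0,1] there exists λ : {1,…,M} → ℝ such that inf{ R_cs(f; c) : f measurable, −δ ≤ MD_m(f) ≤ δ for all m } = inf{ R_cs(f; c) − Σ_{m=1}^M λ_m·MD_m(f) : f measurable 𝒳 → [0,1] }. -/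
open MeasureTheory

/-- Norm-preserving extension of a functional from the common kernel of finitely many linear
functionals yields Lagrange multipliers on the ball of radius `1 / 2`. -/
theorem exists_multipliers_on_ball {E ι : Type*} [NormedAddCommGroup E] [NormedSpace ℝ E]
    [Fintype ι] (ρ : E →L[ℝ] ℝ) (φ : ι → E →ₗ[ℝ] ℝ) (b : ℝ)
    (hb : ∀ h : E, ‖h‖ ≤ 1 / 2 → (∀ i, φ i h = 0) → b ≤ ρ h) :
    ∃ lam : ι → ℝ, ∀ h : E, ‖h‖ ≤ 1 / 2 → b ≤ ρ h - ∑ i, lam i * φ i h := by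
  let K : Submodule ℝ E := ⨅ i, LinearMap.ker (φ i)
  have hK : ∀ h, h ∈ K ↔ ∀ i, φ i h = 0 := fun h => by simp [K]
  have hb0 : b ≤ 0 := by simpa using hb 0 (by norm_num) (by simp)
  obtain ⟨g, hg, hgn⟩ := exists_extension_norm_eq K (ρ.comp K.subtypeL)
  have hnorm : ‖g‖ ≤ -2 * b := by
    rw [hgn]
    refine ContinuousLinearMap.opNorm_le_of_unit_norm (by linarith) fun x hx => ?_
    have hx' : ‖(x : E)‖ = 1 := by simpa using hx
    have hφ := (hK x).1 x.2
    have h1 := hb ((1 / 2 : ℝ) • (x : E)) (by rw [norm_smul, hx']; norm_num) (by simp [hφ])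
    have h2 := hb ((-1 / 2 : ℝ) • (x : E)) (by rw [norm_smul, hx']; norm_num) (by simp [hφ])
    simp only [map_smul, smul_eq_mul] at h1 h2
    simp only [ContinuousLinearMap.comp_apply, Submodule.subtypeL_apply, Real.norm_eq_abs]
    rw [abs_le]
    constructor <;> linarith
  have hspan : (ρ - g : E →L[ℝ] ℝ).toLinearMap ∈ Submodule.span ℝ (Set.range φ) := by
    refine mem_span_of_iInf_ker_le_ker fun x hx => ?_
    have := hg ⟨x, hx⟩
    simp only [ContinuousLinearMap.comp_apply, Submodule.subtypeL_apply] at this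
    simp [this]
  obtain ⟨lam, hlam⟩ := (Submodule.mem_span_range_iff_exists_fun ℝ).1 hspan
  refine ⟨lam, fun h hh => ?_⟩
  have heq : ∑ i, lam i * φ i h = ρ h - g h := by
    simpa using LinearMap.congr_fun hlam h
  have hgh : |g h| ≤ -b := by
    calc |g h| ≤ ‖g‖ * ‖h‖ := g.le_opNorm h
      _ ≤ (-2 * b) * (1 / 2) := by gcongr; linarith
      _ = -b := by ring
  rw [heq]
  linarith [(abs_le.1 hgh).1]

theorem integrable_comp_mul_of_abs_le {Ω 𝒳 : Type*} [MeasurableSpace Ω] [MeasurableSpace 𝒳]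
    {μ : Measure Ω} {X : Ω → 𝒳} (hX : Measurable X) {w : Ω → ℝ} (hw : Integrable w μ)
    {f : 𝒳 → ℝ} (hf : Measurable f) {C : ℝ} (hC : ∀ x, |f x| ≤ C) :
    Integrable (fun ω => f (X ω) * w ω) μ :=
  hw.bdd_mul (c := C) (hf.comp hX).aestronglyMeasurable (Filter.Eventually.of_forall fun ω => hC (X ω))

theorem abs_integral_comp_mul_le {Ω 𝒳 : Type*} [MeasurableSpace Ω]
    {μ : Measure Ω} {X : Ω → 𝒳} {w : Ω → ℝ} (hw : Integrable w μ)
    {f : 𝒳 → ℝ} {C : ℝ} (hC : ∀ x, |f x| ≤ C) :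
    |∫ ω, f (X ω) * w ω ∂μ| ≤ (∫ ω, |w ω| ∂μ) * C := by
  rw [mul_comm, ← integral_const_mul, ← Real.norm_eq_abs]
  refine norm_integral_le_of_norm_le (hw.abs.const_mul C) (Filter.Eventually.of_forall fun ω => ?_)
  rw [Real.norm_eq_abs, abs_mul]
  exact mul_le_mul_of_nonneg_right (hC _) (abs_nonneg _)

/-- Lagrange multipliers for minimizing an integral functional over `[0, 1]`-valued measurable
functions subject to finitely many homogeneous integral constraints satisfied by constants. -/
theorem exists_multipliers_of_integral_constraints {Ω 𝒳 ι : Type*} [MeasurableSpace Ω]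
    [MeasurableSpace 𝒳] [Fintype ι] {μ : Measure Ω} {X : Ω → 𝒳} (hX : Measurable X)
    {v : Ω → ℝ} (hv : Integrable v μ) {w : ι → Ω → ℝ} (hw : ∀ i, Integrable (w i) μ)
    (hw0 : ∀ i, ∫ ω, w i ω ∂μ = 0) (b : ℝ)
    (hb : ∀ f : 𝒳 → ℝ, Measurable f → (∀ x, 0 ≤ f x ∧ f x ≤ 1) →
      (∀ i, ∫ ω, f (X ω) * w i ω ∂μ = 0) → b ≤ ∫ ω, f (X ω) * v ω ∂μ) :
    ∃ lam : ι → ℝ, ∀ f : 𝒳 → ℝ, Measurable f → (∀ x, 0 ≤ f x ∧ f x ≤ 1) →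
      b ≤ ∫ ω, f (X ω) * v ω ∂μ - ∑ i, lam i * ∫ ω, f (X ω) * w i ω ∂μ := by
  let _ : TopologicalSpace 𝒳 := ⊥
  have : DiscreteTopology 𝒳 := ⟨rfl⟩
  let E : Submodule ℝ (BoundedContinuousFunction 𝒳 ℝ) :=
    { carrier := {h | Measurable h}
      add_mem' := fun {a b} ha hb => Measurable.add (f := a) (g := b) ha hb
      zero_mem' := measurable_const (a := (0 : ℝ))
      smul_mem' := fun r a ha => Measurable.const_smul (g := a) ha r }
  have hE : ∀ (h : E) x, |h.1 x| ≤ ‖h‖ := fun h x => h.1.norm_coe_le_norm x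
  have hint : ∀ {u : Ω → ℝ}, Integrable u μ → ∀ h : E,
      Integrable (fun ω => h.1 (X ω) * u ω) μ :=
    fun hu h => integrable_comp_mul_of_abs_le hX hu h.2 (hE h)
  let L : (u : Ω → ℝ) → Integrable u μ → (E →ₗ[ℝ] ℝ) := fun u hu =>
    { toFun := fun h => ∫ ω, h.1 (X ω) * u ω ∂μ
      map_add' := fun a b => by
        rw [← integral_add (hint hu a) (hint hu b)]
        simp [add_mul]
      map_smul' := fun r a => by
        simp [mul_assoc, integral_const_mul] }
  let ρ : E →L[ℝ] ℝ := (L v hv).mkContinuous (∫ ω, |v ω| ∂μ)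
    fun h => abs_integral_comp_mul_le hv (hE h)
  have hshift : ∀ {u : Ω → ℝ}, Integrable u μ → ∀ {f : 𝒳 → ℝ}, Measurable f →
      ∀ {C : ℝ}, (∀ x, |f x| ≤ C) → ∀ r : ℝ,
      ∫ ω, (f (X ω) + r) * u ω ∂μ = ∫ ω, f (X ω) * u ω ∂μ + r * ∫ ω, u ω ∂μ := by
    intro u hu f hf C hC r
    rw [← integral_const_mul, ← integral_add (integrable_comp_mul_of_abs_le hX hu hf hC)
      (hu.const_mul r)]
    simp only [add_mul]
  obtain ⟨lam, hlam⟩ := exists_multipliers_on_ball (E := E) ρ (fun i => L (w i) (hw i))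
    (b - (1 / 2) * ∫ ω, v ω ∂μ) (by
      intro h hh hφ
      have hm : Measurable h.1 := h.2
      have := hb (fun x => h.1 x + 1 / 2) (hm.add_const _) (fun x => by
        have := abs_le.1 ((hE h x).trans hh)
        constructor <;> linarith) (fun i => by
          rw [hshift (hw i) hm (hE h), hw0, mul_zero, add_zero]
          exact hφ i)
      rw [hshift hv hm (hE h)] at this
      change _ ≤ ∫ ω, h.1 (X ω) * v ω ∂μ
      linarith)
  refine ⟨lam, fun f hf hf01 => ?_⟩
  have hfb : ∀ x, |f x + -(1 / 2)| ≤ 1 / 2 := fun x => by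
    rw [abs_le]
    constructor <;> linarith [(hf01 x).1, (hf01 x).2]
  have hf1 : ∀ x, |f x| ≤ 1 := fun x => by rw [abs_of_nonneg (hf01 x).1]; exact (hf01 x).2
  let h : E := ⟨BoundedContinuousFunction.ofNormedAddCommGroupDiscrete
    (fun x => f x + -(1 / 2)) (1 / 2) hfb, hf.add_const _⟩
  have hL : ∀ {u : Ω → ℝ} (hu : Integrable u μ),
      L u hu h = ∫ ω, f (X ω) * u ω ∂μ + -(1 / 2) * ∫ ω, u ω ∂μ :=
    fun hu => hshift hu hf hf1 _
  have hfin := hlam h ((BoundedContinuousFunction.norm_le (by norm_num)).2 hfb)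
  have hρ : ρ h = L v hv h := rfl
  rw [hρ] at hfin
  simp only [hL, hw0, mul_zero, add_zero] at hfin
  linarith

/-- The infimum of a uniformly bounded family of affine functions of `t` attains every value
between its values at `0` and `1`. -/
theorem exists_sInf_image_sub_mul_eq {α : Type*} {A : Set α} (hA : A.Nonempty) {a d : α → ℝ}
    {C D : ℝ} (ha : ∀ f ∈ A, |a f| ≤ C) (hd : ∀ f ∈ A, |d f| ≤ D) {p : ℝ}
    (h0 : sInf (a '' A) ≤ p) (h1 : ∀ f ∈ A, p ≤ a f - d f) :
    ∃ t : ℝ, p = sInf ((fun f => a f - t * d f) '' A) := by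
  let G : ℝ → ℝ := fun t => sInf ((fun f => a f - t * d f) '' A)
  have hbdd : ∀ t, BddBelow ((fun f => a f - t * d f) '' A) := by
    rintro t
    refine ⟨-C - |t| * D, ?_⟩
    rintro _ ⟨f, hf, rfl⟩
    have h2 : |t * d f| ≤ |t| * D := by
      rw [abs_mul]
      exact mul_le_mul_of_nonneg_left (hd f hf) (abs_nonneg t)
    simp only
    linarith [(abs_le.1 (ha f hf)).1, (abs_le.1 h2).2]
  have hD : 0 ≤ D := by
    obtain ⟨f, hf⟩ := hA
    exact (abs_nonneg _).trans (hd f hf)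
  have hlip : LipschitzWith D.toNNReal G := by
    refine LipschitzWith.of_le_add_mul _ fun s t => ?_
    rw [Real.coe_toNNReal _ hD, ← sub_le_iff_le_add]
    refine le_csInf (hA.image _) ?_
    rintro _ ⟨f, hf, rfl⟩
    have h2 : G s ≤ a f - s * d f := csInf_le (hbdd s) ⟨f, hf, rfl⟩
    have h3 : |(s - t) * d f| ≤ D * dist s t := by
      rw [abs_mul, mul_comm D, Real.dist_eq]
      exact mul_le_mul_of_nonneg_left (hd f hf) (abs_nonneg _)
    have h4 := (abs_le.1 h3).1
    simp only
    linarith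
  have hG0 : G 0 ≤ p := by simpa [G] using h0
  have hG1 : p ≤ G 1 := by
    refine le_csInf (hA.image _) ?_
    rintro _ ⟨f, hf, rfl⟩
    simpa using h1 f hf
  obtain ⟨t, -, ht⟩ := intermediate_value_Icc zero_le_one hlip.continuous.continuousOn
    (show p ∈ Set.Icc (G 0) (G 1) from ⟨hG0, hG1⟩)
  exact ⟨t, ht.symm⟩

/-- Lagrangian strong duality for cost-sensitive risk minimization under the
demographic-parity mean-difference constraint: there exist multipliers `λ` such that the
constrained infimum equals the infimum of the Lagrangian over all randomized classifiers. -/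
theorem stmt_12
    {Ω 𝒳 : Type*} [MeasurableSpace Ω] [MeasurableSpace 𝒳]
    (μ : Measure Ω) [IsProbabilityMeasure μ]
    {M : ℕ}
    (X : Ω → 𝒳) (Y : Ω → Bool) (S : Ω → Fin M)
    (hX : Measurable X) (hY : Measurable Y) (hS : Measurable S)
    (hSpos : ∀ m : Fin M, 0 < μ {ω | S ω = m})
    (Rcs : (𝒳 → ℝ) → ℝ) (MDm : (𝒳 → ℝ) → Fin M → ℝ)
    (c : ℝ) (hc : 0 ≤ c ∧ c ≤ 1) (δ : ℝ) (hδ : 0 ≤ δ ∧ δ ≤ 1)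
    (hRcs : ∀ f : 𝒳 → ℝ, Rcs f =
      c * (∫ ω, f (X ω) * Set.indicator {ω' | Y ω' = false} (fun _ => (1:ℝ)) ω ∂μ)
        + (1 - c) * (∫ ω, (1 - f (X ω)) * Set.indicator {ω' | Y ω' = true} (fun _ => (1:ℝ)) ω ∂μ))
    (hMDm : ∀ (f : 𝒳 → ℝ) (m : Fin M), MDm f m =
      (∫ ω, f (X ω) ∂μ)
        - (∫ ω, f (X ω) * Set.indicator {ω' | S ω' = m} (fun _ => (1:ℝ)) ω ∂μ)
            / (μ {ω | S ω = m}).toReal) :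
    ∃ lam : Fin M → ℝ,
      sInf {r : ℝ | ∃ f : 𝒳 → ℝ, Measurable f ∧ (∀ x, 0 ≤ f x ∧ f x ≤ 1)
          ∧ (∀ m : Fin M, -δ ≤ MDm f m ∧ MDm f m ≤ δ) ∧ r = Rcs f}
        = sInf {r : ℝ | ∃ f : 𝒳 → ℝ, Measurable f ∧ (∀ x, 0 ≤ f x ∧ f x ≤ 1)
            ∧ r = Rcs f - ∑ m : Fin M, lam m * MDm f m} := by
  let A : Set (𝒳 → ℝ) := {f | Measurable f ∧ ∀ x, 0 ≤ f x ∧ f x ≤ 1}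
  let B : Set (𝒳 → ℝ) := {f | f ∈ A ∧ ∀ m, -δ ≤ MDm f m ∧ MDm f m ≤ δ}
  let v : Ω → ℝ := fun ω => c * Set.indicator {ω' | Y ω' = false} (fun _ => (1 : ℝ)) ω
    - (1 - c) * Set.indicator {ω' | Y ω' = true} (fun _ => (1 : ℝ)) ω
  let w : Fin M → Ω → ℝ := fun m ω => 1
    - Set.indicator {ω' | S ω' = m} (fun _ => (1 : ℝ)) ω / (μ {ω | S ω = m}).toReal
  let k : ℝ := (1 - c) * ∫ ω, Set.indicator {ω' | Y ω' = true} (fun _ => (1 : ℝ)) ω ∂μ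
  have hYm : ∀ y : Bool, MeasurableSet {ω | Y ω = y} := fun y => hY (measurableSet_singleton y)
  have hSm : ∀ m, MeasurableSet {ω | S ω = m} := fun m => hS (measurableSet_singleton m)
  have hYi : ∀ y : Bool, Integrable (Set.indicator {ω | Y ω = y} (fun _ => (1 : ℝ))) μ :=
    fun y => (integrable_const 1).indicator (hYm y)
  have hSi : ∀ m, Integrable (Set.indicator {ω | S ω = m} (fun _ => (1 : ℝ))) μ :=
    fun m => (integrable_const 1).indicator (hSm m)
  have hv : Integrable v μ := ((hYi false).const_mul c).sub ((hYi true).const_mul (1 - c))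
  have hw : ∀ m, Integrable (w m) μ := fun m => (integrable_const 1).sub ((hSi m).div_const _)
  have habs : ∀ f ∈ A, ∀ x, |f x| ≤ 1 := fun f hf x => by
    rw [abs_of_nonneg (hf.2 x).1]; exact (hf.2 x).2
  have hI : ∀ f ∈ A, ∀ {u : Ω → ℝ}, Integrable u μ → Integrable (fun ω => f (X ω) * u ω) μ :=
    fun f hf _ hu => integrable_comp_mul_of_abs_le hX hu hf.1 (habs f hf)
  have hR : ∀ f ∈ A, Rcs f = ∫ ω, f (X ω) * v ω ∂μ + k := by
    intro f hf
    have h1 : ∀ ω, f (X ω) * v ω =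
        c * (f (X ω) * Set.indicator {ω' | Y ω' = false} (fun _ => (1 : ℝ)) ω)
        - (1 - c) * (f (X ω) * Set.indicator {ω' | Y ω' = true} (fun _ => (1 : ℝ)) ω) :=
      fun ω => by simp only [v]; ring
    simp only [hRcs, h1, sub_mul (1 : ℝ) (f _), one_mul]
    rw [integral_sub (hYi true) (hI f hf (hYi true)),
      integral_sub ((hI f hf (hYi false)).const_mul c) ((hI f hf (hYi true)).const_mul (1 - c)),
      integral_const_mul, integral_const_mul]
    simp only [k]
    ring
  have hMD : ∀ f ∈ A, ∀ m, MDm f m = ∫ ω, f (X ω) * w m ω ∂μ := by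
    intro f hf m
    have h1 : ∀ ω, f (X ω) * w m ω = f (X ω) * 1
        - (f (X ω) * Set.indicator {ω' | S ω' = m} (fun _ => (1 : ℝ)) ω)
          / (μ {ω | S ω = m}).toReal := fun ω => by simp only [w]; ring
    simp only [h1]
    rw [integral_sub (hI f hf (integrable_const 1)) ((hI f hf (hSi m)).div_const _),
      integral_div, hMDm]
    simp only [mul_one]
  have hw0 : ∀ m, ∫ ω, w m ω ∂μ = 0 := by
    intro m
    have hne : (μ {ω | S ω = m}).toReal ≠ 0 :=
      (ENNReal.toReal_pos (hSpos m).ne' (measure_ne_top _ _)).ne'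
    simp only [w]
    rw [integral_sub (integrable_const 1) ((hSi m).div_const _), integral_div,
      integral_indicator_const _ (hSm m)]
    simp [Measure.real, hne]
  have hRb : ∀ f ∈ A, |Rcs f| ≤ (∫ ω, |v ω| ∂μ) * 1 + |k| := fun f hf => by
    rw [hR f hf]
    exact (abs_add_le _ _).trans
      (add_le_add_left (abs_integral_comp_mul_le hv (habs f hf)) _)
  have hbelow : ∀ T ⊆ A, BddBelow (Rcs '' T) := by
    intro T hT
    refine ⟨-((∫ ω, |v ω| ∂μ) * 1 + |k|), ?_⟩
    rintro _ ⟨f, hf, rfl⟩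
    exact (abs_le.1 (hRb f (hT hf))).1
  have hzero : (fun _ => 0 : 𝒳 → ℝ) ∈ B := by
    refine ⟨⟨measurable_const, fun _ => by norm_num⟩, fun m => ?_⟩
    simp [hMDm, hδ.1]
  have hBA : B ⊆ A := fun f hf => hf.1
  obtain ⟨lam, hlam⟩ := exists_multipliers_of_integral_constraints hX hv hw hw0
    (sInf (Rcs '' B) - k) (by
      intro f hf hf01 hfw
      have hfA : f ∈ A := ⟨hf, hf01⟩
      have hfB : f ∈ B := ⟨hfA, fun m => by simp [hMD f hfA, hfw, hδ.1]⟩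
      have := csInf_le (hbelow B hBA) ⟨f, hfB, rfl⟩
      rw [hR f hfA] at this
      linarith)
  obtain ⟨t, ht⟩ := exists_sInf_image_sub_mul_eq (A := A) (a := Rcs)
    (d := fun f => ∑ m, lam m * MDm f m) ⟨_, hBA hzero⟩ hRb
    (D := ∑ m, |lam m| * ((∫ ω, |w m ω| ∂μ) * 1)) (by
      intro f hf
      refine (Finset.abs_sum_le_sum_abs _ _).trans (Finset.sum_le_sum fun m _ => ?_)
      rw [abs_mul, hMD f hf]
      exact mul_le_mul_of_nonneg_left (abs_integral_comp_mul_le (hw m) (habs f hf))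
        (abs_nonneg _))
    (p := sInf (Rcs '' B))
    (csInf_le_csInf (hbelow A subset_rfl) ⟨_, _, hzero, rfl⟩ (Set.image_mono hBA))
    (by
      intro f hf
      have := hlam f hf.1 hf.2
      simp only [hR f hf, hMD f hf]
      linarith)
  refine ⟨fun m => t * lam m, ?_⟩
  convert ht using 2
  · ext r
    simp only [A, B, Set.mem_image, Set.mem_ofPred_eq, and_assoc, eq_comm (a := r)]
  · ext r
    simp only [A, Set.mem_image, Set.mem_ofPred_eq, and_assoc, eq_comm (a := r), Finset.mul_sum,
      mul_assoc]
end

section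
/- Let (Ω, 𝔉, μ) be a probability space with measurable X : Ω → 𝒳, Y : Ω → {0,1}, S : Ω → {1,…,M}, μ(S=m) > 0 for all m. For measurable f : 𝒳 → [0,1] define R_cs(f; c) := c·∫ f(X)·1_{Y=0} dμ + (1−c)·∫ (1−f(X))·1_{Y=1} dμ and, for δ ∈ [0,1], R^MR_m(f) := δ·∫ f∘X dμ − (∫ f(X)·1_{S=m} dμ)/μ(S=m). Then for every c ∈ [0,1] and δ ∈ [0,1] there exists λ : {1,…,M} → ℝ such that inf{ R_cs(f; c) : f measurable, δ − 1 ≤ R^MR_m(f) ≤ 0 for all m } = inf{ R_cs(f; c) − Σ_{m=1}^M λ_m·R^MR_m(f) : f measurable 𝒳 → [0,1] }. -/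
open MeasureTheory

/-- The bounded measurable real functions on a measurable space. -/
def boundedMeasurable (𝒳 : Type*) [MeasurableSpace 𝒳] : Submodule ℝ (𝒳 → ℝ) where
  carrier := {f | Measurable f ∧ ∃ C, ∀ x, |f x| ≤ C}
  add_mem' := by
    rintro f g ⟨hf, C, hC⟩ ⟨hg, D, hD⟩
    exact ⟨hf.add hg, C + D, fun x => (abs_add_le _ _).trans (add_le_add (hC x) (hD x))⟩
  zero_mem' := ⟨measurable_const, 0, fun x => by simp⟩
  smul_mem' := by
    rintro a f ⟨hf, C, hC⟩
    refine ⟨hf.const_smul a, |a| * C, fun x => ?_⟩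
    rw [Pi.smul_apply, smul_eq_mul, abs_mul]
    exact mul_le_mul_of_nonneg_left (hC x) (abs_nonneg a)

namespace boundedMeasurable

variable {Ω 𝒳 : Type*} [MeasurableSpace Ω] [MeasurableSpace 𝒳] {μ : Measure Ω}
  {X : Ω → 𝒳} {w : Ω → ℝ}

/-- The constant function `1`. -/
def one (𝒳 : Type*) [MeasurableSpace 𝒳] : boundedMeasurable 𝒳 :=
  ⟨fun _ => 1, measurable_const, 1, fun _ => by simp⟩

/-- The randomized classifiers: bounded measurable functions with values in `[0, 1]`. -/
def classifiers (𝒳 : Type*) [MeasurableSpace 𝒳] : Set (boundedMeasurable 𝒳) :=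
  {f | ∀ x, 0 ≤ f.1 x ∧ f.1 x ≤ 1}

/-- A measurable function with values in `[0, 1]`, as a bounded measurable function. -/
def ofUnit (f : 𝒳 → ℝ) (hf : Measurable f) (h : ∀ x, 0 ≤ f x ∧ f x ≤ 1) :
    boundedMeasurable 𝒳 :=
  ⟨f, hf, 1, fun x => abs_le.2 ⟨by linarith [(h x).1], (h x).2⟩⟩

lemma convex_classifiers : Convex ℝ (classifiers 𝒳) := by
  intro f hf g hg a b ha hb hab x
  have h1 := hf x
  have h2 := hg x
  simp only [Submodule.coe_add, Submodule.coe_smul, Pi.add_apply, Pi.smul_apply, smul_eq_mul]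
  constructor
  · nlinarith [mul_nonneg ha h1.1, mul_nonneg hb h2.1]
  · nlinarith [mul_le_mul_of_nonneg_left h1.2 ha, mul_le_mul_of_nonneg_left h2.2 hb]

lemma integrable_comp_mul (hX : Measurable X) (hw : Integrable w μ)
    (f : boundedMeasurable 𝒳) : Integrable (fun ω => f.1 (X ω) * w ω) μ := by
  obtain ⟨f, hf, C, hC⟩ := f
  exact hw.bdd_mul (hf.comp hX).aestronglyMeasurable (Filter.Eventually.of_forall fun ω => hC (X ω))

/-- The linear functional `f ↦ ∫ f(X) w dμ` for an integrable weight `w`. -/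
noncomputable def weightedIntegral (hX : Measurable X) (hw : Integrable w μ) :
    boundedMeasurable 𝒳 →ₗ[ℝ] ℝ where
  toFun f := ∫ ω, f.1 (X ω) * w ω ∂μ
  map_add' f g := by
    rw [← integral_add (integrable_comp_mul hX hw f) (integrable_comp_mul hX hw g)]
    exact integral_congr_ae (Filter.Eventually.of_forall fun ω => add_mul _ _ _)
  map_smul' a f := by
    rw [RingHom.id_apply, smul_eq_mul, ← integral_const_mul]
    exact integral_congr_ae (Filter.Eventually.of_forall fun ω => mul_assoc _ _ _)

lemma abs_weightedIntegral_le (hX : Measurable X) (hw : Integrable w μ)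
    {f : boundedMeasurable 𝒳} {C : ℝ} (hC : ∀ x, |f.1 x| ≤ C) :
    |weightedIntegral hX hw f| ≤ C * ∫ ω, |w ω| ∂μ := by
  refine (abs_integral_le_integral_abs).trans ?_
  rw [← integral_const_mul]
  refine integral_mono (integrable_comp_mul hX hw f).abs (hw.abs.const_mul C) fun ω => ?_
  simp only [abs_mul]
  exact mul_le_mul_of_nonneg_right (hC _) (abs_nonneg _)

/-- A linear map from bounded measurable functions to a finite-dimensional space has a
generalized inverse that is bounded for the supremum norm. -/
lemma exists_bounded_preimage {ι : Type*} [Fintype ι]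
    (R : boundedMeasurable 𝒳 →ₗ[ℝ] (ι → ℝ)) :
    ∃ C, 0 ≤ C ∧ ∀ f, ∃ g, R g = R f ∧ ∀ x, |g.1 x| ≤ C * ∑ m, |R f m| := by
  classical
  obtain ⟨σ, hσ⟩ := R.rangeRestrict.exists_rightInverse_of_surjective R.range_rangeRestrict
  obtain ⟨T, hT⟩ := LinearMap.exists_extend σ
  have hRT : ∀ f, R (T (R f)) = R f := fun f => by
    have h1 : T (R f) = σ (R.rangeRestrict f) := by rw [← hT]; rfl
    rw [h1]
    exact congrArg Subtype.val (LinearMap.congr_fun hσ (R.rangeRestrict f))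
  choose B hB using fun m => (T (Pi.single m 1)).2.2
  refine ⟨∑ m, |B m|, Finset.sum_nonneg fun _ _ => abs_nonneg _, fun f => ⟨T (R f), hRT f, ?_⟩⟩
  intro x
  have hsum : T (R f) = ∑ m, R f m • T (Pi.single m 1) := by
    conv_lhs => rw [pi_eq_sum_univ' (R f)]
    simp only [map_sum, map_smul]
  rw [hsum]
  simp only [Submodule.coe_sum, Submodule.coe_smul, Finset.sum_apply, Pi.smul_apply, smul_eq_mul]
  refine (Finset.abs_sum_le_sum_abs _ _).trans ?_
  rw [Finset.mul_sum]
  refine Finset.sum_le_sum fun m _ => ?_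
  rw [abs_mul, mul_comm]
  refine mul_le_mul_of_nonneg_right ?_ (abs_nonneg _)
  exact ((hB m x).trans (le_abs_self _)).trans
    (Finset.single_le_sum (f := fun m => |B m|) (fun _ _ => abs_nonneg _) (Finset.mem_univ m))

/-- Error bound: the distance of a classifier to the feasible set is controlled by the size of its
constraint values. -/
lemma exists_feasible_near {ι : Type*} [Fintype ι] {δ : ℝ} (hδ : δ ≤ 1)
    (R : boundedMeasurable 𝒳 →ₗ[ℝ] (ι → ℝ)) (hR : ∀ m, R (one 𝒳) m = δ - 1) :
    ∃ C, 0 ≤ C ∧ ∀ f ∈ classifiers 𝒳, ∃ f' ∈ classifiers 𝒳,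
      (∀ m, δ - 1 ≤ R f' m ∧ R f' m ≤ 0) ∧ ∀ x, |(f' - f).1 x| ≤ C * ∑ m, |R f m| := by
  have hle : ∀ f m, |R f m| ≤ ∑ m, |R f m| := fun f m =>
    Finset.single_le_sum (f := fun m => |R f m|) (fun _ _ => abs_nonneg _) (Finset.mem_univ m)
  have hs0 : ∀ f, 0 ≤ ∑ m, |R f m| := fun f => Finset.sum_nonneg fun _ _ => abs_nonneg _
  rcases hδ.lt_or_eq with h | rfl
  · have hd : 0 < 1 - δ := by linarith
    refine ⟨2 / (1 - δ), by positivity, fun f hf => ?_⟩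
    set s := ∑ m, |R f m| with hs
    have hs1 : 0 ≤ s := hs0 f
    set η := 2 / (1 - δ) * s with hη
    have hη0 : 0 ≤ η := by positivity
    have hηs : η * (1 - δ) = 2 * s := by rw [hη]; field_simp
    have hpos : 0 < 1 + η := by linarith
    refine ⟨(1 + η)⁻¹ • (f + (η / 2) • one 𝒳), fun x => ?_, fun m => ?_, fun x => ?_⟩
    · have := hf x
      simp only [one, Submodule.coe_add, Submodule.coe_smul, Pi.add_apply, Pi.smul_apply,
        smul_eq_mul]
      constructor
      · have : 0 ≤ f.1 x + η / 2 * 1 := by linarith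
        positivity
      · rw [inv_mul_le_iff₀ hpos]; linarith
    · have h1 := abs_le.1 (hle f m)
      simp only [map_add, map_smul, Pi.add_apply, Pi.smul_apply, smul_eq_mul, hR]
      rw [le_inv_mul_iff₀ hpos, inv_mul_le_iff₀ hpos]
      constructor <;> nlinarith
    · have := hf x
      simp only [one, Submodule.coe_sub, Submodule.coe_add, Submodule.coe_smul, Pi.add_apply,
        Pi.sub_apply, Pi.smul_apply, smul_eq_mul]
      have e : (1 + η)⁻¹ * (f.1 x + η / 2 * 1) - f.1 x = (1 + η)⁻¹ * (η * (1 / 2 - f.1 x)) := by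
        field_simp; ring
      rw [e, abs_le, le_inv_mul_iff₀ hpos, inv_mul_le_iff₀ hpos]
      constructor <;> nlinarith [mul_nonneg hη0 this.1, mul_le_mul_of_nonneg_left this.2 hη0]
  · obtain ⟨C, hC, hg⟩ := exists_bounded_preimage R
    refine ⟨2 * C, by positivity, fun f hf => ?_⟩
    obtain ⟨g, hgR, hgx⟩ := hg f
    set s := ∑ m, |R f m| with hs
    have hs1 : 0 ≤ s := hs0 f
    set η := C * s with hη
    have hη0 : 0 ≤ η := by positivity
    have hpos : 0 < 1 + 2 * η := by linarith
    refine ⟨(1 + 2 * η)⁻¹ • (f - g + η • one 𝒳), fun x => ?_, fun m => ?_, fun x => ?_⟩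
    · have := hf x
      have h2 := abs_le.1 (hgx x)
      simp only [one, Submodule.coe_sub, Submodule.coe_add, Submodule.coe_smul, Pi.add_apply,
        Pi.sub_apply, Pi.smul_apply, smul_eq_mul]
      rw [le_inv_mul_iff₀ hpos, inv_mul_le_iff₀ hpos]
      constructor <;> linarith
    · simp [hgR, hR]
    · have := hf x
      have h2 := abs_le.1 (hgx x)
      simp only [one, Submodule.coe_sub, Submodule.coe_add, Submodule.coe_smul, Pi.add_apply,
        Pi.sub_apply, Pi.smul_apply, smul_eq_mul]
      have e : (1 + 2 * η)⁻¹ * (f.1 x - g.1 x + η * 1) - f.1 x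
          = (1 + 2 * η)⁻¹ * (η - g.1 x - 2 * η * f.1 x) := by
        field_simp; ring
      rw [e, mul_assoc 2 C s, ← hη, abs_le, le_inv_mul_iff₀ hpos, inv_mul_le_iff₀ hpos]
      constructor <;> nlinarith [mul_nonneg hη0 this.1, mul_le_mul_of_nonneg_left this.2 hη0]

end boundedMeasurable

/-- Exact `ℓ¹` penalization of a convex problem yields a Lagrange multiplier. -/
lemma exists_multiplier_of_penalty {V ι : Type*} [AddCommGroup V] [Module ℝ V] [Fintype ι]
    {F : Set V} (hF : Convex ℝ F) (R : V →ₗ[ℝ] (ι → ℝ)) (A : V →ₗ[ℝ] ℝ) {p L : ℝ} (hL : 0 ≤ L)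
    (h : ∀ f ∈ F, p ≤ A f + L * ∑ m, |R f m|) :
    ∃ lam : ι → ℝ, ∀ f ∈ F, p ≤ A f - ∑ m, lam m * R f m := by
  classical
  rcases F.eq_empty_or_nonempty with rfl | ⟨f₀, hf₀⟩
  · exact ⟨0, by simp⟩
  let N : (ι → ℝ) → ℝ := fun z => p - L * ∑ m, |z m|
  have hNcont : Continuous N := by fun_prop
  have hNconc : ConcaveOn ℝ Set.univ N := by
    refine ⟨convex_univ, fun x _ y _ a b ha hb hab => ?_⟩
    have : ∑ m, |(a • x + b • y) m| ≤ a * ∑ m, |x m| + b * ∑ m, |y m| := by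
      rw [Finset.mul_sum, Finset.mul_sum, ← Finset.sum_add_distrib]
      refine Finset.sum_le_sum fun m _ => ?_
      refine (abs_add_le _ _).trans (le_of_eq ?_)
      simp [abs_mul, abs_of_nonneg ha, abs_of_nonneg hb]
    have h2 := mul_le_mul_of_nonneg_left this hL
    simp only [N, smul_eq_mul]
    have : p = a * p + b * p := by rw [← add_mul, hab, one_mul]
    nlinarith
  let B : Set ((ι → ℝ) × ℝ) := {q | q.1 ∈ Set.univ ∧ q.2 < N q.1}
  have hBo : IsOpen B := by
    have : B = {q | q.2 < N q.1} := by ext; simp [B]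
    rw [this]
    exact isOpen_lt continuous_snd (hNcont.comp continuous_fst)
  have hBc : Convex ℝ B := hNconc.convex_strict_hypograph
  have hAc : Convex ℝ ((R.prod A) '' F) := hF.linear_image _
  have hdis : Disjoint B ((R.prod A) '' F) := by
    rw [Set.disjoint_left]
    rintro _ ⟨-, hq⟩ ⟨f, hf, rfl⟩
    have := h f hf
    simp only [LinearMap.prod_apply, Function.prod_apply, N] at hq
    linarith
  obtain ⟨φ, u, hφB, hφA⟩ := geometric_hahn_banach_open hBc hBo hAc hdis
  have hφ : ∀ z r, φ (z, r) = (∑ m, φ (Pi.single m 1, 0) * z m) + φ (0, 1) * r := by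
    intro z r
    have e : ((z, r) : (ι → ℝ) × ℝ) = (∑ m, z m • (Pi.single m (1 : ℝ), (0 : ℝ))) + r • (0, 1) := by
      refine Prod.ext ?_ ?_
      · simp only [Prod.fst_add, Prod.fst_sum, Prod.smul_fst, smul_zero, add_zero]
        exact pi_eq_sum_univ' z
      · simp [Prod.snd_sum]
    rw [e, map_add, map_sum]
    simp only [map_smul, smul_eq_mul, mul_comm]
  set s := φ (0, 1) with hs
  have hB : ∀ z r, r < N z → (∑ m, φ (Pi.single m 1, 0) * z m) + s * r < u := fun z r hr => by
    rw [← hφ]; exact hφB _ ⟨Set.mem_univ _, hr⟩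
  have hA : ∀ f ∈ F, u ≤ (∑ m, φ (Pi.single m 1, 0) * R f m) + s * A f := fun f hf => by
    rw [← hφ]; exact hφA _ ⟨f, hf, rfl⟩
  have hspos : 0 < s := by
    -- compare the values of `φ` above the common point `R f₀`
    have h1 := hA f₀ hf₀
    have h2 := hB (R f₀) (min (A f₀) (N (R f₀)) - 1)
      (by linarith [min_le_right (A f₀) (N (R f₀))])
    have h3 : s * (min (A f₀) (N (R f₀)) - 1) < s * A f₀ := by linarith
    by_contra hcon
    have := mul_le_mul_of_nonpos_left
      (show min (A f₀) (N (R f₀)) - 1 ≤ A f₀ by linarith [min_le_left (A f₀) (N (R f₀))])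
      (not_lt.1 hcon)
    linarith
  have hsp : s * p ≤ u := by
    refine le_of_forall_pos_lt_add fun ε hε => ?_
    have h1 := hB 0 (p - ε / s) (by simp only [N]; simp; positivity)
    have h2 : s * (p - ε / s) = s * p - ε := by field_simp
    simp only [Pi.zero_apply, mul_zero, Finset.sum_const_zero, h2] at h1
    linarith
  refine ⟨fun m => -(φ (Pi.single m 1, 0) / s), fun f hf => ?_⟩
  have h1 := hsp.trans (hA f hf)
  have h2 : ∑ m, -(φ (Pi.single m 1, 0) / s) * R f m
      = -((∑ m, φ (Pi.single m 1, 0) * R f m) / s) := by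
    rw [Finset.sum_div, ← Finset.sum_neg_distrib]
    exact Finset.sum_congr rfl fun m _ => by ring
  rw [h2, sub_neg_eq_add]
  have h3 : p - A f ≤ (∑ m, φ (Pi.single m 1, 0) * R f m) / s := by
    rw [le_div_iff₀ hspos]; linarith
  linarith

/-- Intermediate values of the concave function `t ↦ ⨅ i, a i - t * b i` on `[0, 1]`. -/
lemma exists_iInf_sub_mul_eq {ι : Type*} [Nonempty ι] {a b : ι → ℝ} {l K p : ℝ}
    (ha : ∀ i, l ≤ a i) (hb : ∀ i, |b i| ≤ K) (h0 : ⨅ i, a i ≤ p) (h1 : ∀ i, p ≤ a i - b i) :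
    ∃ t : ℝ, ⨅ i, (a i - t * b i) = p := by
  have hK : 0 ≤ K := (abs_nonneg _).trans (hb (Classical.arbitrary ι))
  have hbd : ∀ t : ℝ, BddBelow (Set.range fun i => a i - t * b i) := by
    rintro t
    refine ⟨l - |t| * K, ?_⟩
    rintro _ ⟨i, rfl⟩
    have : t * b i ≤ |t| * K := (le_abs_self _).trans
      ((abs_mul _ _).trans_le (mul_le_mul_of_nonneg_left (hb i) (abs_nonneg _)))
    linarith [ha i]
  have hcont : Continuous fun t : ℝ => ⨅ i, (a i - t * b i) := by
    refine (LipschitzWith.of_le_add_mul ⟨K, hK⟩ fun s t => ?_).continuous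
    rw [← sub_le_iff_le_add]
    refine le_ciInf fun i => ?_
    have h2 := ciInf_le (hbd s) i
    have : (t - s) * b i ≤ |s - t| * K := (le_abs_self _).trans
      ((abs_mul _ _).trans_le (by
        rw [abs_sub_comm]; exact mul_le_mul_of_nonneg_left (hb i) (abs_nonneg _)))
    change _ - K * |s - t| ≤ _
    linarith
  obtain ⟨t, -, ht⟩ := intermediate_value_Icc (zero_le_one' ℝ) hcont.continuousOn
    (show p ∈ Set.Icc _ _ from ⟨by simpa using h0, by
      simpa only [one_mul] using le_ciInf h1⟩)
  exact ⟨t, ht⟩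

/-- Lagrangian strong duality for cost-sensitive risk minimization under the
demographic-parity mean-ratio constraint `δ − 1 ≤ R^MR_m(f) ≤ 0` with
`R^MR_m(f) = δ·(overall acceptance rate) − (group-m acceptance rate)`. -/
theorem stmt_13
    {Ω 𝒳 : Type*} [MeasurableSpace Ω] [MeasurableSpace 𝒳]
    (μ : Measure Ω) [IsProbabilityMeasure μ]
    {M : ℕ}
    (X : Ω → 𝒳) (Y : Ω → Bool) (S : Ω → Fin M)
    (hX : Measurable X) (hY : Measurable Y) (hS : Measurable S)
    (hSpos : ∀ m : Fin M, 0 < μ {ω | S ω = m})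
    (Rcs : (𝒳 → ℝ) → ℝ) (RMRm : (𝒳 → ℝ) → Fin M → ℝ)
    (c : ℝ) (hc : 0 ≤ c ∧ c ≤ 1) (δ : ℝ) (hδ : 0 ≤ δ ∧ δ ≤ 1)
    (hRcs : ∀ f : 𝒳 → ℝ, Rcs f =
      c * (∫ ω, f (X ω) * Set.indicator {ω' | Y ω' = false} (fun _ => (1:ℝ)) ω ∂μ)
        + (1 - c) * (∫ ω, (1 - f (X ω)) * Set.indicator {ω' | Y ω' = true} (fun _ => (1:ℝ)) ω ∂μ))
    (hRMRm : ∀ (f : 𝒳 → ℝ) (m : Fin M), RMRm f m =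
      δ * (∫ ω, f (X ω) ∂μ)
        - (∫ ω, f (X ω) * Set.indicator {ω' | S ω' = m} (fun _ => (1:ℝ)) ω ∂μ)
            / (μ {ω | S ω = m}).toReal) :
    ∃ lam : Fin M → ℝ,
      sInf {r : ℝ | ∃ f : 𝒳 → ℝ, Measurable f ∧ (∀ x, 0 ≤ f x ∧ f x ≤ 1)
          ∧ (∀ m : Fin M, δ - 1 ≤ RMRm f m ∧ RMRm f m ≤ 0) ∧ r = Rcs f}
        = sInf {r : ℝ | ∃ f : 𝒳 → ℝ, Measurable f ∧ (∀ x, 0 ≤ f x ∧ f x ≤ 1)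
            ∧ r = Rcs f - ∑ m : Fin M, lam m * RMRm f m} := by
  classical
  set V := boundedMeasurable 𝒳
  set F : Set V := boundedMeasurable.classifiers 𝒳
  have hmY : ∀ y, MeasurableSet {ω | Y ω = y} := fun y => hY (measurableSet_singleton y)
  have hmS : ∀ m, MeasurableSet {ω | S ω = m} := fun m => hS (measurableSet_singleton m)
  have hindY : ∀ y, Integrable ({ω | Y ω = y}.indicator fun _ => (1 : ℝ)) μ := fun y =>
    (integrable_const 1).indicator (hmY y)
  have hindS : ∀ m, Integrable ({ω | S ω = m}.indicator fun _ => (1 : ℝ)) μ := fun m =>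
    (integrable_const 1).indicator (hmS m)
  have hone : Integrable (fun _ : Ω => (1 : ℝ)) μ := integrable_const 1
  let I₀ : V →ₗ[ℝ] ℝ := boundedMeasurable.weightedIntegral hX (hindY false)
  let I₁ : V →ₗ[ℝ] ℝ := boundedMeasurable.weightedIntegral hX (hindY true)
  let P : V →ₗ[ℝ] ℝ := boundedMeasurable.weightedIntegral hX hone
  let J : Fin M → V →ₗ[ℝ] ℝ := fun m => boundedMeasurable.weightedIntegral hX (hindS m)
  let A : V →ₗ[ℝ] ℝ := c • I₀ - (1 - c) • I₁
  let R : V →ₗ[ℝ] (Fin M → ℝ) :=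
    LinearMap.pi fun m => δ • P - (μ {ω | S ω = m}).toReal⁻¹ • J m
  set b : ℝ := (1 - c) * ∫ ω, {ω | Y ω = true}.indicator (fun _ => (1 : ℝ)) ω ∂μ
  have hRcs' : ∀ f : V, Rcs f.1 = A f + b := fun f => by
    have e : ∫ ω, (1 - f.1 (X ω)) * {ω | Y ω = true}.indicator (fun _ => (1 : ℝ)) ω ∂μ
        = (∫ ω, {ω | Y ω = true}.indicator (fun _ => (1 : ℝ)) ω ∂μ) - I₁ f := by
      refine Eq.trans ?_ (integral_sub (hindY true)
        (boundedMeasurable.integrable_comp_mul hX (hindY true) f))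
      exact integral_congr_ae (Filter.Eventually.of_forall fun ω => by
        simp only [sub_mul, one_mul])
    rw [hRcs, e]
    change c * I₀ f + _ = c * I₀ f - (1 - c) * I₁ f + _
    ring
  have hRcs_ofUnit : ∀ f hf h01, Rcs f = A (boundedMeasurable.ofUnit f hf h01) + b :=
    fun f hf h01 => hRcs' (boundedMeasurable.ofUnit f hf h01)
  have hR' : ∀ (f : V) m, RMRm f.1 m = R f m := fun f m => by
    have e : ∫ ω, f.1 (X ω) ∂μ = P f :=
      integral_congr_ae (Filter.Eventually.of_forall fun ω => (mul_one _).symm)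
    rw [hRMRm, e, div_eq_inv_mul]
    rfl
  have hR1 : ∀ m, R (boundedMeasurable.one 𝒳) m = δ - 1 := fun m => by
    have hne : (μ {ω | S ω = m}).toReal ≠ 0 :=
      (ENNReal.toReal_pos (hSpos m).ne' (measure_ne_top _ _)).ne'
    rw [← hR', hRMRm]
    simp only [boundedMeasurable.one, one_mul, integral_const, smul_eq_mul, mul_one,
      integral_indicator_const _ (hmS m), measureReal_def, measure_univ, ENNReal.toReal_one]
    rw [div_self hne]
  obtain ⟨C, hC, hfeas⟩ := boundedMeasurable.exists_feasible_near hδ.2 R hR1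
  -- crude bounds on the objective and the constraints
  have hIb : ∀ {w : Ω → ℝ} (hw : Integrable w μ), ∃ K, 0 ≤ K ∧ ∀ (f : V) (D : ℝ),
      (∀ x, |f.1 x| ≤ D) → |boundedMeasurable.weightedIntegral hX hw f| ≤ D * K := fun {w} hw =>
    ⟨∫ ω, |w ω| ∂μ, integral_nonneg fun _ => abs_nonneg _, fun f D hD =>
      boundedMeasurable.abs_weightedIntegral_le hX hw hD⟩
  obtain ⟨K₀, hK₀, hI₀⟩ := hIb (hindY false)
  obtain ⟨K₁, hK₁, hI₁⟩ := hIb (hindY true)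
  obtain ⟨KP, -, hP⟩ := hIb hone
  choose KJ _ hJ using fun m => hIb (hindS m)
  have hAb : ∀ (f : V) (D : ℝ), (∀ x, |f.1 x| ≤ D) → |A f| ≤ D * (K₀ + K₁) := fun f D hD => by
    have h0' : |c * I₀ f| ≤ D * K₀ := by
      rw [abs_mul, abs_of_nonneg hc.1]
      exact (mul_le_of_le_one_left (abs_nonneg _) hc.2).trans (hI₀ f D hD)
    have h1' : |(1 - c) * I₁ f| ≤ D * K₁ := by
      rw [abs_mul, abs_of_nonneg (sub_nonneg.2 hc.2)]
      exact (mul_le_of_le_one_left (abs_nonneg _) (by linarith [hc.1])).trans (hI₁ f D hD)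
    refine (abs_sub (c * I₀ f) ((1 - c) * I₁ f)).trans ?_
    linarith
  have hFabs : ∀ f ∈ F, ∀ x, |f.1 x| ≤ 1 := fun f hf x =>
    abs_le.2 ⟨by linarith [(hf x).1], (hf x).2⟩
  have hAl : ∀ f ∈ F, -(K₀ + K₁) ≤ A f := fun f hf => by
    have := (abs_le.1 (hAb f 1 (hFabs f hf))).1
    linarith
  have hRb : ∀ m, ∃ K, ∀ f ∈ F, |R f m| ≤ K := fun m =>
    ⟨|δ| * KP + |(μ {ω | S ω = m}).toReal⁻¹| * KJ m, fun f hf => by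
      have h1 := hP f 1 (hFabs f hf)
      have h2 := hJ m f 1 (hFabs f hf)
      rw [one_mul] at h1 h2
      refine (abs_sub (δ * P f) ((μ {ω | S ω = m}).toReal⁻¹ * J m f)).trans ?_
      rw [abs_mul, abs_mul]
      exact add_le_add (mul_le_mul_of_nonneg_left h1 (abs_nonneg _))
        (mul_le_mul_of_nonneg_left h2 (abs_nonneg _))⟩
  choose KR hKR using hRb
  set Q : Set ℝ := {r : ℝ | ∃ f : 𝒳 → ℝ, Measurable f ∧ (∀ x, 0 ≤ f x ∧ f x ≤ 1)
    ∧ (∀ m : Fin M, δ - 1 ≤ RMRm f m ∧ RMRm f m ≤ 0) ∧ r = Rcs f}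
  have hQmem : ∀ f ∈ F, (∀ m, δ - 1 ≤ R f m ∧ R f m ≤ 0) → A f + b ∈ Q := fun f hf hfR =>
    ⟨f.1, f.2.1, hf, fun m => by rw [hR']; exact hfR m, (hRcs' f).symm⟩
  have hQbdd : BddBelow Q := by
    refine ⟨-(K₀ + K₁) + b, ?_⟩
    rintro _ ⟨f, hf, hf01, -, rfl⟩
    rw [hRcs_ofUnit f hf hf01]
    linarith [hAl (boundedMeasurable.ofUnit f hf hf01) hf01]
  have h0F : (0 : V) ∈ F := fun x => ⟨le_rfl, zero_le_one⟩
  have hQne : Q.Nonempty := ⟨_, hQmem 0 h0F fun m => by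
    rw [map_zero, Pi.zero_apply]; exact ⟨by linarith [hδ.2], le_rfl⟩⟩
  have hpen : ∀ f ∈ F, sInf Q - b ≤ A f + C * (K₀ + K₁) * ∑ m, |R f m| := fun f hf => by
    obtain ⟨f', hf', hf'R, hnear⟩ := hfeas f hf
    have h1 := csInf_le hQbdd (hQmem f' hf' hf'R)
    have h2 := (abs_le.1 (hAb _ _ hnear)).2
    rw [map_sub] at h2
    nlinarith
  obtain ⟨lam, hlam⟩ := exists_multiplier_of_penalty boundedMeasurable.convex_classifiers R A
    (mul_nonneg hC (add_nonneg hK₀ hK₁)) hpen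
  have : Nonempty F := ⟨⟨0, h0F⟩⟩
  obtain ⟨t, ht⟩ := exists_iInf_sub_mul_eq (ι := F) (a := fun f => A f.1 + b)
    (b := fun f => ∑ m, lam m * R f.1 m) (l := -(K₀ + K₁) + b) (K := ∑ m, |lam m| * KR m)
    (p := sInf Q) (fun f => by linarith [hAl f.1 f.2])
    (fun f => (Finset.abs_sum_le_sum_abs _ _).trans (Finset.sum_le_sum fun m _ => by
      rw [abs_mul]; exact mul_le_mul_of_nonneg_left (hKR m f.1 f.2) (abs_nonneg _)))
    (by
      refine le_csInf hQne ?_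
      rintro _ ⟨f, hf, hf01, -, rfl⟩
      rw [hRcs_ofUnit f hf hf01]
      refine ciInf_le (f := fun f : F => A f.1 + b) ⟨-(K₀ + K₁) + b, ?_⟩
        ⟨boundedMeasurable.ofUnit f hf hf01, hf01⟩
      rintro _ ⟨g, rfl⟩
      simp only
      linarith [hAl g.1 g.2])
    (fun f => by linarith [hlam f.1 f.2])
  refine ⟨fun m => t * lam m, ?_⟩
  rw [← ht, iInf]
  congr 1
  have hval : ∀ f : V, Rcs f.1 - ∑ m, t * lam m * RMRm f.1 m
      = A f + b - t * ∑ m, lam m * R f m := fun f => by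
    simp only [hRcs', hR', Finset.mul_sum, mul_assoc]
  ext r
  constructor
  · rintro ⟨f, rfl⟩
    exact ⟨f.1.1, f.1.2.1, f.2, (hval f.1).symm⟩
  · rintro ⟨f, hf, hf01, rfl⟩
    exact ⟨⟨boundedMeasurable.ofUnit f hf hf01, hf01⟩,
      (hval (boundedMeasurable.ofUnit f hf hf01)).symm⟩
end

section
/- Let (Ω, 𝔉, μ) be a probability space with measurable X : Ω → 𝒳, Y : Ω → {0,1}, S : Ω → {1,…,M}, with μ(Y=y, S=m) > 0 for all y ∈ {0,1} and m. For measurable f : 𝒳 → [0,1] define R_cs(f; c) := c·∫ f(X)·1_{Y=0} dμ + (1−c)·∫ (1−f(X))·1_{Y=1} dμ, MD^EO_m(f) := (∫ f(X)·1_{Y=1} dμ)/μ(Y=1) − (∫ f(X)·1_{Y=1,S=m} dμ)/μ(Y=1, S=m), and MD^PE_m(f) := (∫ f(X)·1_{Y=0} dμ)/μ(Y=0) − (∫ f(X)·1_{Y=0,S=m} dμ)/μ(Y=0, S=m). Then for every c ∈ [0,1] and δ ∈ [0,1] there exist λ^EO, λ^PE : {1,…,M} → ℝ such that inf{ R_cs(f;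 c) : f measurable, −δ ≤ MD^EO_m(f) ≤ δ and −δ ≤ MD^PE_m(f) ≤ δ for all m } = inf{ R_cs(f; c) − Σ_{m=1}^M λ^EO_m·MD^EO_m(f) − Σ_{m=1}^M λ^PE_m·MD^PE_m(f) : f measurable 𝒳 → [0,1] }. -/
open MeasureTheory

/-- Two nonnegative multiples of points of a convex set add up to a nonnegative multiple of a
point of that set. -/
theorem Convex.exists_smul_eq_smul_add_smul {E : Type*} [AddCommGroup E] [Module ℝ E]
    {K : Set E} (hK : Convex ℝ K) {a b : ℝ} (ha : 0 ≤ a) (hb : 0 ≤ b) {x y : E}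
    (hx : x ∈ K) (hy : y ∈ K) : ∃ z ∈ K, (a + b) • z = a • x + b • y := by
  rcases (add_nonneg ha hb).eq_or_lt with h | h
  · obtain rfl : a = 0 := by linarith
    obtain rfl : b = 0 := by linarith
    exact ⟨x, hx, by simp⟩
  · refine ⟨(a / (a + b)) • x + (b / (a + b)) • y,
      hK hx hy (by positivity) (by positivity) (by field_simp), ?_⟩
    rw [smul_add, smul_smul, smul_smul, mul_div_cancel₀ _ h.ne', mul_div_cancel₀ _ h.ne']

/-- A convex set of pairs (constraint value, objective value) whose projection to the constraint
space is symmetric has a nonvertical supporting hyperplane below any lower bound of the objective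
on the zero fibre. -/
theorem Convex.exists_le_snd_add_of_symm {F : Type*} [AddCommGroup F] [Module ℝ F]
    {K : Set (F × ℝ)} (hK : Convex ℝ K) (hne : K.Nonempty)
    (hsymm : ∀ k ∈ K, ∃ r, (-k.1, r) ∈ K) {p : ℝ} (hp : ∀ r, ((0 : F), r) ∈ K → p ≤ r) :
    ∃ l : F →ₗ[ℝ] ℝ, ∀ k ∈ K, p ≤ k.2 + l k.1 := by
  have hadd : ∀ {a b : ℝ}, 0 ≤ a → 0 ≤ b → ∀ {x y : F × ℝ}, x ∈ K → y ∈ K →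
      ∃ z ∈ K, (a + b) • z.1 = a • x.1 + b • y.1 ∧
        (a + b) * (z.2 - p) = a * (x.2 - p) + b * (y.2 - p) := by
    intro a b ha hb x y hx hy
    obtain ⟨z, hz, h⟩ := hK.exists_smul_eq_smul_add_smul ha hb hx hy
    refine ⟨z, hz, congrArg Prod.fst h, ?_⟩
    have h2 : (a + b) * z.2 = a * x.2 + b * y.2 := congrArg Prod.snd h
    linear_combination h2
  obtain ⟨k₀, hk₀⟩ := hne
  let W : Submodule ℝ F :=
    { carrier := {u | ∃ t : ℝ, 0 ≤ t ∧ ∃ k ∈ K, u = t • k.1}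
      zero_mem' := ⟨0, le_rfl, k₀, hk₀, by simp⟩
      add_mem' := by
        rintro _ _ ⟨a, ha, x, hx, rfl⟩ ⟨b, hb, y, hy, rfl⟩
        obtain ⟨z, hz, h, -⟩ := hadd ha hb hx hy
        exact ⟨a + b, add_nonneg ha hb, z, hz, h.symm⟩
      smul_mem' := by
        rintro c _ ⟨a, ha, x, hx, rfl⟩
        rcases le_total 0 c with hc | hc
        · exact ⟨c * a, mul_nonneg hc ha, x, hx, smul_smul _ _ _⟩
        · obtain ⟨r, hr⟩ := hsymm x hx
          exact ⟨-c * a, mul_nonneg (neg_nonneg.2 hc) ha, _, hr, by simp [smul_smul]⟩ }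
  let s : PointedCone ℝ (W × ℝ) :=
    { carrier := {x | ∃ t : ℝ, 0 ≤ t ∧ ∃ k ∈ K, (x.1 : F) = t • k.1 ∧ t * (k.2 - p) ≤ x.2}
      zero_mem' := ⟨0, le_rfl, k₀, hk₀, by simp, by simp⟩
      add_mem' := by
        rintro u v ⟨a, ha, x, hx, hux, hu⟩ ⟨b, hb, y, hy, hvy, hv⟩
        obtain ⟨z, hz, h, h'⟩ := hadd ha hb hx hy
        refine ⟨a + b, add_nonneg ha hb, z, hz, ?_, ?_⟩
        · rw [h, ← hux, ← hvy]; rfl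
        · rw [h']; exact add_le_add hu hv
      smul_mem' := by
        rintro ⟨c, hc⟩ u ⟨a, ha, x, hx, hux, hu⟩
        refine ⟨c * a, mul_nonneg hc ha, x, hx, ?_, ?_⟩
        · rw [mul_smul, ← hux]; rfl
        · rw [mul_assoc]; exact mul_le_mul_of_nonneg_left hu hc }
  let f : (W × ℝ) →ₗ.[ℝ] ℝ :=
    { domain := LinearMap.ker (LinearMap.fst ℝ W ℝ)
      toFun := (LinearMap.snd ℝ W ℝ).comp (Submodule.subtype _) }
  obtain ⟨g, hg, hgs⟩ := riesz_extension s f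
    (by
      rintro ⟨⟨u, r⟩, hu⟩ ⟨t, ht, k, hk, huk, hr⟩
      obtain rfl : u = 0 := hu
      change 0 ≤ r
      refine le_trans ?_ hr
      rcases ht.eq_or_lt with rfl | ht
      · simp
      · have h0 : k.1 = 0 := by
          have : t • k.1 = 0 := huk.symm
          exact (smul_eq_zero.1 this).resolve_left ht.ne'
        have hk' : ((0 : F), k.2) ∈ K := by rw [← h0]; exact hk
        exact mul_nonneg ht.le (sub_nonneg.2 (hp _ hk')))
    (by
      rintro ⟨⟨u, t, ht, k, hk, hu⟩, q⟩
      refine ⟨⟨(0, t * (k.2 - p) - q), rfl⟩, t, ht, k, hk, ?_, ?_⟩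
      · simpa using hu
      · simp)
  obtain ⟨l, hl⟩ := (g.comp (LinearMap.inl ℝ W ℝ)).exists_extend
  refine ⟨l, fun k hk => ?_⟩
  have hkW : k.1 ∈ W := ⟨1, zero_le_one, k, hk, (one_smul _ _).symm⟩
  have h1 : 0 ≤ g (⟨k.1, hkW⟩, k.2 - p) :=
    hgs _ ⟨1, zero_le_one, k, hk, (one_smul _ _).symm, (one_mul _).le⟩
  have h2 : g (0, k.2 - p) = k.2 - p := hg ⟨(0, k.2 - p), rfl⟩
  have h3 : l k.1 = g (⟨k.1, hkW⟩, 0) := LinearMap.congr_fun hl ⟨k.1, hkW⟩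
  have h4 : g (⟨k.1, hkW⟩, k.2 - p) = g (⟨k.1, hkW⟩, 0) + g (0, k.2 - p) := by
    rw [← map_add]; simp
  linarith

/-- For bounded `a` and `b`, the infimum of `a i + t * b i` over `i` depends continuously
on `t`. -/
theorem continuous_iInf_add_mul {ι : Type*} [Nonempty ι] {a b : ι → ℝ} {A B : ℝ}
    (ha : ∀ i, A ≤ a i) (hb : ∀ i, |b i| ≤ B) :
    Continuous fun t : ℝ => ⨅ i, (a i + t * b i) := by
  refine (LipschitzWith.of_le_add_mul' B fun x y => ?_).continuous
  rw [← sub_le_iff_le_add]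
  refine le_ciInf fun i => ?_
  have hbdd : BddBelow (Set.range fun i => a i + x * b i) := by
    refine ⟨A - |x| * B, ?_⟩
    rintro _ ⟨j, rfl⟩
    have h1 : |x * b j| ≤ |x| * B := by
      rw [abs_mul]; exact mul_le_mul_of_nonneg_left (hb j) (abs_nonneg x)
    have := neg_abs_le (x * b j)
    have := ha j
    dsimp only
    linarith
  have h1 := ciInf_le hbdd i
  have h2 : |(x - y) * b i| ≤ B * dist x y := by
    rw [abs_mul, mul_comm, Real.dist_eq]
    exact mul_le_mul_of_nonneg_right (hb i) (abs_nonneg _)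
  have h3 := le_abs_self ((x - y) * b i)
  linarith

/-- Strong duality for a convex set of pairs (constraint value, objective value) with symmetric
constraint values: for a constraint region containing `0`, some multiplier makes the
Lagrangian infimum equal to the constrained infimum. -/
theorem Convex.exists_sInf_eq_sInf_add {F : Type*} [AddCommGroup F] [Module ℝ F]
    {K : Set (F × ℝ)} (hK : Convex ℝ K) (hne : K.Nonempty)
    (hsymm : ∀ k ∈ K, ∃ r, (-k.1, r) ∈ K) {A : ℝ} (hA : ∀ k ∈ K, A ≤ k.2)
    (hbdd : ∀ l : F →ₗ[ℝ] ℝ, ∃ B, ∀ k ∈ K, |l k.1| ≤ B) {D : Set F} (hD : 0 ∈ D) :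
    ∃ l : F →ₗ[ℝ] ℝ,
      sInf {r : ℝ | ∃ k ∈ K, k.1 ∈ D ∧ r = k.2} = sInf {r : ℝ | ∃ k ∈ K, r = k.2 + l k.1} := by
  set T : Set ℝ := {r : ℝ | ∃ k ∈ K, k.1 ∈ D ∧ r = k.2} with hT
  have hTb : BddBelow T := by
    refine ⟨A, ?_⟩
    rintro _ ⟨k, hk, -, rfl⟩
    exact hA k hk
  have hTne : T.Nonempty := by
    obtain ⟨k, hk⟩ := hne
    obtain ⟨r, hr⟩ := hsymm k hk
    refine ⟨_, _, hK hk hr (by norm_num : (0 : ℝ) ≤ 1 / 2) (by norm_num : (0 : ℝ) ≤ 1 / 2)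
      (by norm_num), ?_, rfl⟩
    simpa using hD
  obtain ⟨l, hl⟩ := hK.exists_le_snd_add_of_symm hne hsymm (p := sInf T)
    fun r hr => csInf_le hTb ⟨_, hr, hD, rfl⟩
  obtain ⟨B, hB⟩ := hbdd l
  have := hne.to_subtype
  have hcont := continuous_iInf_add_mul (ι := K) (a := fun k => k.1.2) (b := fun k => l k.1.1)
    (fun k => hA _ k.2) (fun k => hB _ k.2)
  have h0 : (⨅ k : K, (k.1.2 + 0 * l k.1.1)) ≤ sInf T := by
    refine le_csInf hTne ?_
    rintro _ ⟨k, hk, -, rfl⟩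
    refine (ciInf_le ⟨A, ?_⟩ (⟨k, hk⟩ : K)).trans (by simp)
    rintro _ ⟨j, rfl⟩
    simpa using hA _ j.2
  have h1 : sInf T ≤ ⨅ k : K, (k.1.2 + 1 * l k.1.1) :=
    le_ciInf fun k => by simpa using hl _ k.2
  obtain ⟨t, -, ht⟩ := intermediate_value_Icc zero_le_one hcont.continuousOn ⟨h0, h1⟩
  refine ⟨t • l, ht.symm.trans (congrArg sInf ?_)⟩
  ext r
  simp [eq_comm]

section IndicatorIntegrals

variable {Ω : Type*} [MeasurableSpace Ω] {μ : Measure Ω} [IsFiniteMeasure μ] {T : Set Ω}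
  {f g : Ω → ℝ}

theorem integrable_mul_indicator_one (hT : MeasurableSet T) (hf : Measurable f)
    (h : ∀ ω, 0 ≤ f ω ∧ f ω ≤ 1) :
    Integrable (fun ω => f ω * T.indicator (fun _ => (1 : ℝ)) ω) μ := by
  refine Integrable.of_bound (hf.mul (measurable_const.indicator hT)).aestronglyMeasurable 1
    (.of_forall fun ω => ?_)
  have := h ω
  by_cases hω : ω ∈ T <;> simp [hω, abs_le] <;> constructor <;> linarith

theorem integral_mul_indicator_one_mem_Icc (hT : MeasurableSet T) (hf : Measurable f)
    (h : ∀ ω, 0 ≤ f ω ∧ f ω ≤ 1) :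
    ∫ ω, f ω * T.indicator (fun _ => (1 : ℝ)) ω ∂μ ∈ Set.Icc 0 (μ T).toReal := by
  have hnn : ∀ ω, 0 ≤ T.indicator (fun _ => (1 : ℝ)) ω :=
    fun ω => Set.indicator_nonneg (fun _ _ => zero_le_one) ω
  refine ⟨integral_nonneg fun ω => mul_nonneg (h ω).1 (hnn ω), ?_⟩
  calc ∫ ω, f ω * T.indicator (fun _ => (1 : ℝ)) ω ∂μ
      ≤ ∫ ω, T.indicator (fun _ => (1 : ℝ)) ω ∂μ :=
        integral_mono (integrable_mul_indicator_one hT hf h)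
          ((integrable_const (1 : ℝ)).indicator hT)
          fun ω => mul_le_of_le_one_left (hnn ω) (h ω).2
    _ = (μ T).toReal := by rw [integral_indicator_const _ hT]; simp [Measure.real]

theorem integral_one_sub_mul_indicator_one (hT : MeasurableSet T) (hf : Measurable f)
    (h : ∀ ω, 0 ≤ f ω ∧ f ω ≤ 1) :
    ∫ ω, (1 - f ω) * T.indicator (fun _ => (1 : ℝ)) ω ∂μ
      = (μ T).toReal - ∫ ω, f ω * T.indicator (fun _ => (1 : ℝ)) ω ∂μ := by
  simp_rw [sub_mul, one_mul]
  rw [integral_sub ((integrable_const (1 : ℝ)).indicator hT)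
    (integrable_mul_indicator_one hT hf h), integral_indicator_const _ hT]
  simp [Measure.real]

theorem integral_combo_mul_indicator_one (hT : MeasurableSet T) (hf : Measurable f)
    (h : ∀ ω, 0 ≤ f ω ∧ f ω ≤ 1) (hg : Measurable g) (h' : ∀ ω, 0 ≤ g ω ∧ g ω ≤ 1) (a b : ℝ) :
    ∫ ω, (a * f ω + b * g ω) * T.indicator (fun _ => (1 : ℝ)) ω ∂μ
      = a * (∫ ω, f ω * T.indicator (fun _ => (1 : ℝ)) ω ∂μ)
        + b * ∫ ω, g ω * T.indicator (fun _ => (1 : ℝ)) ω ∂μ := by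
  simp_rw [add_mul, mul_assoc]
  rw [integral_add ((integrable_mul_indicator_one hT hf h).const_mul a)
    ((integrable_mul_indicator_one hT hg h').const_mul b), integral_const_mul, integral_const_mul]

end IndicatorIntegrals

/-- A linear functional on a product of two coordinate spaces is a sum of two weighted sums. -/
theorem LinearMap.apply_prod_pi {ι : Type*} [Fintype ι] [DecidableEq ι]
    (l : (ι → ℝ) × (ι → ℝ) →ₗ[ℝ] ℝ) (u v : ι → ℝ) :
    l (u, v) = (∑ i, l (Pi.single i 1, 0) * u i) + ∑ i, l (0, Pi.single i 1) * v i := by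
  have hl : l (u, v) = (l ∘ₗ LinearMap.inl ℝ _ _) u + (l ∘ₗ LinearMap.inr ℝ _ _) v := by
    simp [← map_add]
  have hs : ∀ i : ι, (fun j => if i = j then (1 : ℝ) else 0) = Pi.single i 1 := by
    intro i; ext j; simp [Pi.single_apply, eq_comm]
  rw [hl, LinearMap.pi_apply_eq_sum_univ, LinearMap.pi_apply_eq_sum_univ (l ∘ₗ _) v]
  simp [hs, mul_comm]

/-- Lagrangian strong duality for cost-sensitive risk minimization under the
Equalized Odds constraints (equal-opportunity and predictive-equality mean differences both
bounded by `δ` in absolute value for every group). -/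
theorem stmt_17
    {Ω 𝒳 : Type*} [MeasurableSpace Ω] [MeasurableSpace 𝒳]
    (μ : Measure Ω) [IsProbabilityMeasure μ]
    {M : ℕ}
    (X : Ω → 𝒳) (Y : Ω → Bool) (S : Ω → Fin M)
    (hX : Measurable X) (hY : Measurable Y) (hS : Measurable S)
    (hpos : ∀ (y : Bool) (m : Fin M), 0 < μ {ω | Y ω = y ∧ S ω = m})
    (Rcs : (𝒳 → ℝ) → ℝ) (MDEO MDPE : (𝒳 → ℝ) → Fin M → ℝ)
    (c : ℝ) (hc : 0 ≤ c ∧ c ≤ 1) (δ : ℝ) (hδ : 0 ≤ δ ∧ δ ≤ 1)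
    (hRcs : ∀ f : 𝒳 → ℝ, Rcs f =
      c * (∫ ω, f (X ω) * Set.indicator {ω' | Y ω' = false} (fun _ => (1:ℝ)) ω ∂μ)
        + (1 - c) * (∫ ω, (1 - f (X ω)) * Set.indicator {ω' | Y ω' = true} (fun _ => (1:ℝ)) ω ∂μ))
    (hMDEO : ∀ (f : 𝒳 → ℝ) (m : Fin M), MDEO f m =
      (∫ ω, f (X ω) * Set.indicator {ω' | Y ω' = true} (fun _ => (1:ℝ)) ω ∂μ)
          / (μ {ω | Y ω = true}).toReal
        - (∫ ω, f (X ω) * Set.indicator {ω' | Y ω' = true ∧ S ω' = m} (fun _ => (1:ℝ)) ω ∂μ)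
            / (μ {ω | Y ω = true ∧ S ω = m}).toReal)
    (hMDPE : ∀ (f : 𝒳 → ℝ) (m : Fin M), MDPE f m =
      (∫ ω, f (X ω) * Set.indicator {ω' | Y ω' = false} (fun _ => (1:ℝ)) ω ∂μ)
          / (μ {ω | Y ω = false}).toReal
        - (∫ ω, f (X ω) * Set.indicator {ω' | Y ω' = false ∧ S ω' = m} (fun _ => (1:ℝ)) ω ∂μ)
            / (μ {ω | Y ω = false ∧ S ω = m}).toReal) :
    ∃ lamEO lamPE : Fin M → ℝ,
      sInf {r : ℝ | ∃ f : 𝒳 → ℝ, Measurable f ∧ (∀ x, 0 ≤ f x ∧ f x ≤ 1)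
          ∧ (∀ m : Fin M, (-δ ≤ MDEO f m ∧ MDEO f m ≤ δ)
              ∧ (-δ ≤ MDPE f m ∧ MDPE f m ≤ δ))
          ∧ r = Rcs f}
        = sInf {r : ℝ | ∃ f : 𝒳 → ℝ, Measurable f ∧ (∀ x, 0 ≤ f x ∧ f x ≤ 1)
            ∧ r = Rcs f - (∑ m : Fin M, lamEO m * MDEO f m)
                - ∑ m : Fin M, lamPE m * MDPE f m} := by
  have hYm : ∀ y : Bool, MeasurableSet {ω | Y ω = y} := fun y => hY (measurableSet_singleton y)
  have hSm : ∀ (y : Bool) (m : Fin M), MeasurableSet {ω | Y ω = y ∧ S ω = m} :=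
    fun y m => (hYm y).inter (hS (measurableSet_singleton m))
  have hpos₂ : ∀ (y : Bool) (m : Fin M), 0 < (μ {ω | Y ω = y ∧ S ω = m}).toReal :=
    fun y m => ENNReal.toReal_pos (hpos y m).ne' (measure_ne_top _ _)
  have hpos₁ : ∀ (y : Bool) (_ : Fin M), 0 < (μ {ω | Y ω = y}).toReal := fun y m =>
    ENNReal.toReal_pos ((hpos y m).trans_le (measure_mono fun _ h => h.1)).ne' (measure_ne_top _ _)
  let C : Set (𝒳 → ℝ) := {f | Measurable f ∧ ∀ x, 0 ≤ f x ∧ f x ≤ 1}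
  have hcomp : ∀ f ∈ C, Measurable (fun ω => f (X ω)) ∧ ∀ ω, 0 ≤ f (X ω) ∧ f (X ω) ≤ 1 :=
    fun f hf => ⟨hf.1.comp hX, fun ω => hf.2 _⟩
  have hmem : ∀ {T : Set Ω}, MeasurableSet T → ∀ f ∈ C,
      ∫ ω, f (X ω) * T.indicator (fun _ => (1 : ℝ)) ω ∂μ ∈ Set.Icc 0 (μ T).toReal :=
    fun hT f hf => integral_mul_indicator_one_mem_Icc hT (hcomp f hf).1 (hcomp f hf).2
  have hsub : ∀ {T : Set Ω}, MeasurableSet T → ∀ f ∈ C,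
      ∫ ω, (1 - f (X ω)) * T.indicator (fun _ => (1 : ℝ)) ω ∂μ
        = (μ T).toReal - ∫ ω, f (X ω) * T.indicator (fun _ => (1 : ℝ)) ω ∂μ :=
    fun hT f hf => integral_one_sub_mul_indicator_one hT (hcomp f hf).1 (hcomp f hf).2
  have hcombo : ∀ {T : Set Ω}, MeasurableSet T → ∀ f ∈ C, ∀ g ∈ C, ∀ a b : ℝ,
      ∫ ω, (a * f (X ω) + b * g (X ω)) * T.indicator (fun _ => (1 : ℝ)) ω ∂μ
        = a * (∫ ω, f (X ω) * T.indicator (fun _ => (1 : ℝ)) ω ∂μ)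
          + b * ∫ ω, g (X ω) * T.indicator (fun _ => (1 : ℝ)) ω ∂μ :=
    fun hT f hf g hg a b => integral_combo_mul_indicator_one hT (hcomp f hf).1 (hcomp f hf).2
      (hcomp g hg).1 (hcomp g hg).2 a b
  have hone : ∀ f ∈ C, (fun x => 1 - f x) ∈ C := fun f hf =>
    ⟨hf.1.const_sub 1, fun x => ⟨sub_nonneg.2 (hf.2 x).2, sub_le_self _ (hf.2 x).1⟩⟩
  have hconv : ∀ f ∈ C, ∀ g ∈ C, ∀ a b : ℝ, 0 ≤ a → 0 ≤ b → a + b = 1 →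
      (fun x => a * f x + b * g x) ∈ C := by
    intro f hf g hg a b ha hb hab
    refine ⟨(hf.1.const_mul a).add (hg.1.const_mul b), fun x => ⟨?_, ?_⟩⟩
    · exact add_nonneg (mul_nonneg ha (hf.2 x).1) (mul_nonneg hb (hg.2 x).1)
    · have h1 := mul_le_mul_of_nonneg_left (hf.2 x).2 ha
      have h2 := mul_le_mul_of_nonneg_left (hg.2 x).2 hb
      linarith
  have habs : ∀ {a b p q : ℝ}, 0 < p → 0 < q → a ∈ Set.Icc 0 p → b ∈ Set.Icc 0 q →
      |a / p - b / q| ≤ 1 := by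
    intro a b p q hp hq ha hb
    have h1 := div_nonneg ha.1 hp.le
    have h2 := div_le_one_of_le₀ ha.2 hp.le
    have h3 := div_nonneg hb.1 hq.le
    have h4 := div_le_one_of_le₀ hb.2 hq.le
    rw [abs_le]; constructor <;> linarith
  let K : Set (((Fin M → ℝ) × (Fin M → ℝ)) × ℝ) := (fun f => ((MDEO f, MDPE f), Rcs f)) '' C
  have hK : Convex ℝ K := by
    rintro _ ⟨f, hf, rfl⟩ _ ⟨g, hg, rfl⟩ a b ha hb hab
    have hC := hconv f hf g hg a b ha hb hab
    refine ⟨_, hC, Prod.ext (Prod.ext (funext fun m => ?_) (funext fun m => ?_)) ?_⟩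
    · simp only [Prod.fst_add, Prod.smul_fst, Pi.add_apply, Pi.smul_apply, smul_eq_mul, hMDEO,
        hcombo (hYm true) f hf g hg, hcombo (hSm true m) f hf g hg]
      ring
    · simp only [Prod.fst_add, Prod.smul_fst, Prod.snd_add, Prod.smul_snd, Pi.add_apply,
        Pi.smul_apply, smul_eq_mul, hMDPE,
        hcombo (hYm false) f hf g hg, hcombo (hSm false m) f hf g hg]
      ring
    · simp only [Prod.snd_add, Prod.smul_snd, smul_eq_mul, hRcs]
      rw [hsub (hYm true) _ hC, hsub (hYm true) f hf, hsub (hYm true) g hg,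
        hcombo (hYm true) f hf g hg, hcombo (hYm false) f hf g hg]
      linear_combination (-(1 - c) * (μ {ω | Y ω = true}).toReal) * hab
  have hne : K.Nonempty :=
    ⟨_, fun _ => 0, ⟨measurable_const, fun _ => ⟨le_rfl, zero_le_one⟩⟩, rfl⟩
  have hsymm : ∀ k ∈ K, ∃ r, (-k.1, r) ∈ K := by
    rintro _ ⟨f, hf, rfl⟩
    refine ⟨_, _, hone f hf, Prod.ext (Prod.ext (funext fun m => ?_) (funext fun m => ?_)) rfl⟩
    · simp only [Prod.fst_neg, Pi.neg_apply, hMDEO, hsub (hYm true) f hf, hsub (hSm true m) f hf]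
      have h1 := (hpos₁ true m).ne'
      have h2 := (hpos₂ true m).ne'
      rw [sub_div, sub_div, div_self h1, div_self h2]
      ring
    · simp only [Prod.snd_neg, Pi.neg_apply, hMDPE, hsub (hYm false) f hf,
        hsub (hSm false m) f hf]
      have h1 := (hpos₁ false m).ne'
      have h2 := (hpos₂ false m).ne'
      rw [sub_div, sub_div, div_self h1, div_self h2]
      ring
  have hA : ∀ k ∈ K, 0 ≤ k.2 := by
    rintro _ ⟨f, hf, rfl⟩
    simp only [hRcs]
    exact add_nonneg (mul_nonneg hc.1 (hmem (hYm false) f hf).1)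
      (mul_nonneg (sub_nonneg.2 hc.2) (hmem (hYm true) _ (hone f hf)).1)
  have hbdd : ∀ l : (Fin M → ℝ) × (Fin M → ℝ) →ₗ[ℝ] ℝ, ∃ B, ∀ k ∈ K, |l k.1| ≤ B := by
    intro l
    refine ⟨(∑ m, |l (Pi.single m 1, 0)|) + ∑ m, |l (0, Pi.single m 1)|, ?_⟩
    rintro _ ⟨f, hf, rfl⟩
    change |l (MDEO f, MDPE f)| ≤ _
    rw [l.apply_prod_pi]
    refine (abs_add_le _ _).trans (add_le_add ?_ ?_) <;>
      refine (Finset.abs_sum_le_sum_abs _ _).trans (Finset.sum_le_sum fun m _ => ?_) <;>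
      rw [abs_mul] <;> refine mul_le_of_le_one_right (abs_nonneg _) ?_
    · rw [hMDEO]
      exact habs (hpos₁ true m) (hpos₂ true m) (hmem (hYm true) f hf) (hmem (hSm true m) f hf)
    · rw [hMDPE]
      exact habs (hpos₁ false m) (hpos₂ false m) (hmem (hYm false) f hf) (hmem (hSm false m) f hf)
  obtain ⟨l, hl⟩ := hK.exists_sInf_eq_sInf_add hne hsymm hA hbdd
    (D := {u | ∀ m, (-δ ≤ u.1 m ∧ u.1 m ≤ δ) ∧ (-δ ≤ u.2 m ∧ u.2 m ≤ δ)})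
    (by simp [hδ.1])
  refine ⟨fun m => -l (Pi.single m 1, 0), fun m => -l (0, Pi.single m 1), ?_⟩
  convert hl using 2
  · ext r
    simp only [K, C, Set.mem_ofPred_eq, Set.exists_mem_image, and_assoc]
  · ext r
    have hL : ∀ f, Rcs f - (∑ m, -l (Pi.single m 1, 0) * MDEO f m)
        - ∑ m, -l (0, Pi.single m 1) * MDPE f m = Rcs f + l (MDEO f, MDPE f) := by
      intro f
      rw [l.apply_prod_pi]
      simp only [neg_mul, Finset.sum_neg_distrib]
      ring
    simp only [K, C, Set.mem_ofPred_eq, Set.exists_mem_image, and_assoc, hL]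
end
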